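/- arXiv:math/0105131 — 4 statements merged into one kernel-verified Lean document; each statement's English description precedes it below -/
import Mathlib

section
/- Let B be a ring, τ a ring automorphism of B, δ a τ-derivation of B (δ(ab) = δ(a)b + τ(a)δ(b)), and let B' = B[x; τ, δ] be the Ore (skew polynomial) extension: B' is a ring containing B, the powers 1, x, x², … form a free basis of B' as a left B-module, and xa = τ(a)x + δ(a) for all a ∈ B. Let S be a multiplicatively closed subset of B consisting of regular elements, satisfying the left and right Ore conditions in B (for every s ∈ S, b ∈ B there exist s₁ ∈ S, b₁ ∈ B with s₁b = b₁s, and s₂ ∈ S, b₂ ∈ B with bs₂ = sb₂), and stable under τ and τ^{-1}. Then S satisfies the left and right Ore conditions in B'; in particular, for every s ∈ S and every positive integer n there exist t, t' ∈ S and b, b' ∈ B' such that t x^n = b s and x^n t' = s b'. -/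
/- Common definitions for the formalization of
   "Stratification of prime spectrum of quantum solvable algebras" (A. N. Panov). -/

noncomputable section

namespace Panov

variable {R : Type*}

/-- A two-sided ideal `P` is *prime* if it is proper and for all two-sided ideals
`A`, `B`, `AB ⊆ P` implies `A ⊆ P` or `B ⊆ P`. -/
def IsPrimeTS [Ring R] (P : TwoSidedIdeal R) : Prop :=
  P ≠ ⊤ ∧ ∀ A B : TwoSidedIdeal R, (∀ a ∈ A, ∀ b ∈ B, a * b ∈ P) → A ≤ P ∨ B ≤ P

/-- A two-sided ideal is *semiprime* if it is an intersection of prime ideals. -/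
def IsSemiprimeTS [Ring R] (P : TwoSidedIdeal R) : Prop :=
  ∃ s : Set (TwoSidedIdeal R), (∀ Q ∈ s, IsPrimeTS Q) ∧ P = sInf s

/-- A two-sided ideal is *completely prime* if the quotient ring is a domain. -/
def IsCompletelyPrimeTS [Ring R] (P : TwoSidedIdeal R) : Prop :=
  P ≠ ⊤ ∧ ∀ a b : R, a * b ∈ P → a ∈ P ∨ b ∈ P

/-- A *denominator set*: a multiplicatively closed set of regular elements satisfying
the left and right Ore conditions. -/
structure IsDenominatorSet [Ring R] (S : Set R) : Prop where
  one_mem : (1 : R) ∈ S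
  mul_mem : ∀ s ∈ S, ∀ t ∈ S, s * t ∈ S
  regular : ∀ s ∈ S, IsRegular s
  oreL : ∀ s ∈ S, ∀ b : R, ∃ t ∈ S, ∃ c : R, t * b = c * s
  oreR : ∀ s ∈ S, ∀ b : R, ∃ t ∈ S, ∃ c : R, b * t = s * c

/-- `f : B →+* B'` realizes `B'` as the (two-sided) Ore localization of `B` at `S`. -/
structure IsOreLocalizationHom {B B' : Type*} [Ring B] [Ring B']
    (f : B →+* B') (S : Set B) : Prop where
  isUnit : ∀ s ∈ S, IsUnit (f s)
  surjR : ∀ y : B', ∃ b : B, ∃ s ∈ S, y * f s = f b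
  surjL : ∀ y : B', ∃ b : B, ∃ s ∈ S, f s * y = f b
  ker : ∀ a : B, f a = 0 → ∃ s ∈ S, a * s = 0

/-- `f : B →+* D` realizes the division ring `D` as the skew field of fractions
`Fract(B)` of `B` (Ore localization at all nonzero elements). -/
def IsFractionDivisionRing (B : Type*) [Ring B] (D : Type*) [DivisionRing D]
    (f : B →+* D) : Prop :=
  Function.Injective f ∧ ∀ d : D, ∃ s b : B, s ≠ 0 ∧ d = (f s)⁻¹ * f b

/-- A ring `B` is *pure quantum* if in its skew field of fractions (any realization of it)
there are no elements `x`, `y` with `x*y - y*x = 1`. -/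
def PureQuantum (B : Type*) [Ring B] : Prop :=
  ∀ (D : Type*) (_ : DivisionRing D) (f : B →+* D),
    IsFractionDivisionRing B D f → ¬ ∃ x y : D, x * y - y * x = 1

/-- Ordered Laurent monomial `Y₁^{s₁} ⋯ Y_N^{s_N}` in the units `Y i`. -/
def lmon {B : Type*} [Monoid B] {N : ℕ} (Y : Fin N → Bˣ) (s : Fin N → ℤ) : B :=
  (((List.finRange N).map fun i => ((Y i ^ s i : Bˣ) : B))).prod

/-- Ordered monomial `Y₁^{s₁} ⋯ Y_N^{s_N}` with nonnegative exponents. -/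
def nmon {B : Type*} [Monoid B] {N : ℕ} (Y : Fin N → B) (s : Fin N → ℕ) : B :=
  (((List.finRange N).map fun i => (Y i ^ s i))).prod

/-- `B` is an algebra of twisted Laurent polynomials over `C₀` with commutation matrix `p`
and generators `Y`. -/
structure IsTwistedLaurent (C₀ : Type*) [CommRing C₀] (B : Type*) [Ring B] [Algebra C₀ B]
    {N : ℕ} (p : Fin N → Fin N → C₀ˣ) (Y : Fin N → Bˣ) : Prop where
  anti : ∀ i j, p i j * p j i = 1
  diag : ∀ i, p i i = 1
  rel : ∀ i j, (Y i : B) * (Y j : B) = ((p i j : C₀) : C₀) • ((Y j : B) * (Y i : B))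
  free : LinearIndependent C₀ (fun s : Fin N → ℤ => lmon Y s)
  spans : ∀ b : B, b ∈ Submodule.span C₀ (Set.range fun s : Fin N → ℤ => lmon Y s)

/-- `B` is an algebra of twisted polynomials over `C₀`. -/
structure IsTwistedPoly (C₀ : Type*) [CommRing C₀] (B : Type*) [Ring B] [Algebra C₀ B]
    {N : ℕ} (p : Fin N → Fin N → C₀ˣ) (Y : Fin N → B) : Prop where
  anti : ∀ i j, p i j * p j i = 1
  diag : ∀ i, p i i = 1
  rel : ∀ i j, Y i * Y j = ((p i j : C₀) : C₀) • (Y j * Y i)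
  free : LinearIndependent C₀ (fun s : Fin N → ℕ => nmon Y s)
  spans : ∀ b : B, b ∈ Submodule.span C₀ (Set.range fun s : Fin N → ℕ => nmon Y s)

/-- `B'` is a factor ring (homomorphic image) of an algebra of twisted Laurent
polynomials over the commutative ring `C₀`. -/
def IsTwistedLaurentFactorOver (C₀ : Type*) [CommRing C₀] (B' : Type*) [Ring B'] : Prop :=
  ∃ (L : Type) (_ : Ring L) (_ : Algebra C₀ L) (N : ℕ)
    (p : Fin N → Fin N → C₀ˣ) (Y : Fin N → Lˣ),
    IsTwistedLaurent C₀ L p Y ∧ ∃ g : L →+* B', Function.Surjective g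

/-- `B'` is a factor ring of an algebra of twisted Laurent polynomials over some
localization of `C₀` (a commutative ring receiving `C₀`). -/
def IsTwistedLaurentFactor (C₀ : Type*) [CommRing C₀] (B' : Type*) [Ring B'] : Prop :=
  ∃ (C₁ : Type) (_ : CommRing C₁) (_ : C₀ →+* C₁), IsTwistedLaurentFactorOver C₁ B'

/-- Torsionfree subgroup of a group. -/
def TorsionFreeSubgroup {G : Type*} [Group G] (Γ : Subgroup G) : Prop :=
  ∀ γ ∈ Γ, γ ≠ 1 → ¬ IsOfFinOrder γ

/-- The underlying generators-and-parameters data of a quantum solvable algebra. -/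
structure QSData (C : Type*) (R : Type*) [CommRing C] [Ring R] [Algebra C R] where
  n : ℕ
  m : ℕ
  /-- the solvable generators `x₁, …, x_n` -/
  x : Fin n → R
  /-- the invertible generators `k₁^{±1}, …, k_m^{±1}` -/
  k : Fin m → Rˣ
  /-- commutation parameters `q_{ij}` -/
  q : Fin n → Fin n → Cˣ
  /-- the parameters `q_i` of Condition Q1 -/
  qi : Fin n → Cˣ
  /-- parameters for `k_j x_i = qk j i • x_i k_j` -/
  qk : Fin m → Fin n → Cˣ
  /-- parameters for `k_j k_{j'} = qkk j j' • k_{j'} k_j` -/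
  qkk : Fin m → Fin m → Cˣ
  /-- the lower-order terms `r_{ij}` -/
  r : Fin n → Fin n → R
  /-- the diagonal automorphisms `τ_i` of Condition Q3 (extended to all of `R`) -/
  τ : Fin n → (R ≃ₐ[C] R)

namespace QSData

variable {C R : Type*} [CommRing C] [Ring R] [Algebra C R] (D : QSData C R)

/-- The set `{k_j^{±1}}`. -/
def kSet : Set R := (Set.range fun j => ((D.k j : R))) ∪ (Set.range fun j => (((D.k j)⁻¹ : Rˣ) : R))

/-- The subalgebra `R_t` generated by `x_t, x_{t+1}, …, x_n` (0-indexed: indices `≥ t`)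
and `k₁^{±1}, …, k_m^{±1}`. -/
def Rsub (t : ℕ) : Subalgebra C R :=
  Algebra.adjoin C ((D.x '' {i | t ≤ (i : ℕ)}) ∪ D.kSet)

/-- The monomial `x₁^{t₁} ⋯ x_n^{t_n} k₁^{s₁} ⋯ k_m^{s_m}`. -/
def mon (t : Fin D.n → ℕ) (s : Fin D.m → ℤ) : R :=
  (((List.finRange D.n).map fun i => D.x i ^ t i)).prod *
    (((List.finRange D.m).map fun j => ((D.k j ^ s j : Rˣ) : R))).prod

/-- The subgroup `Γ` of `C^*` generated by all commutation parameters. -/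
def Γ : Subgroup Cˣ :=
  Subgroup.closure ((Set.range fun p : Fin D.n × Fin D.n => D.q p.1 p.2) ∪ Set.range D.qi ∪
    (Set.range fun p : Fin D.m × Fin D.n => D.qk p.1 p.2) ∪
    (Set.range fun p : Fin D.m × Fin D.m => D.qkk p.1 p.2))

/-- The `τ_i`-derivation `δ_i`, recovered from `x_i a = τ_i(a) x_i + δ_i(a)`. -/
def δ (i : Fin D.n) (a : R) : R := D.x i * a - D.τ i a * D.x i

/-- A two-sided ideal is `H`-stable for the group `H` generated by the `τ_i`. -/
def HStable (P : TwoSidedIdeal R) : Prop :=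
  ∀ i : Fin D.n, ∀ a : R, a ∈ P ↔ D.τ i a ∈ P

/-- A two-sided ideal has zero intersection with `C`. -/
def ZeroInterC (P : TwoSidedIdeal R) : Prop :=
  ∀ c : C, algebraMap C R c ∈ P → c = 0

end QSData

/-- The two-sided ideal `R·E` of `R` generated by an ideal `E` of `C`. -/
def extIdeal {C : Type*} (R : Type*) [CommRing C] [Ring R] [Algebra C R] (E : Ideal C) :
    TwoSidedIdeal R :=
  TwoSidedIdeal.span (algebraMap C R '' E)

/-- `R/RE` is a domain which is finitely generated as a module over its center. -/
def QuotDomainFiniteCenter {C : Type*} (R : Type*) [CommRing C] [Ring R] [Algebra C R]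
    (E : Ideal C) : Prop :=
  IsDomain (extIdeal R E).ringCon.Quotient ∧
    Module.Finite (Subring.center (extIdeal R E).ringCon.Quotient)
      (extIdeal R E).ringCon.Quotient

/-- A quantum solvable algebra over `C` satisfying Conditions Q1–Q4. -/
structure QuantumSolvable (C R : Type*) [CommRing C] [Ring R] [Algebra C R]
    extends QSData C R : Type _ where
  /-- the monomials are linearly independent over `C` … -/
  free : LinearIndependent C
    (fun p : (Fin toQSData.n → ℕ) × (Fin toQSData.m → ℤ) => toQSData.mon p.1 p.2)
  /-- … and span `R`, i.e. they form a free `C`-basis -/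
  spans : ∀ a : R, a ∈ Submodule.span C
    (Set.range fun p : (Fin toQSData.n → ℕ) × (Fin toQSData.m → ℤ) => toQSData.mon p.1 p.2)
  /-- each `k_j` `q`-commutes with each `x_i` -/
  k_comm_x : ∀ (j : Fin toQSData.m) (i : Fin toQSData.n), ((toQSData.k j : R)) * toQSData.x i =
    ((toQSData.qk j i : Cˣ) : C) • (toQSData.x i * (toQSData.k j : R))
  /-- the `k_j` `q`-commute among themselves -/
  k_comm_k : ∀ (j j' : Fin toQSData.m), ((toQSData.k j : R)) * (toQSData.k j' : R) =
    ((toQSData.qkk j j' : Cˣ) : C) • ((toQSData.k j' : R) * (toQSData.k j : R))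
  q_anti : ∀ (i j : Fin toQSData.n), toQSData.q i j * toQSData.q j i = 1
  q_diag : ∀ (i : Fin toQSData.n), toQSData.q i i = 1
  /-- `r_{ij}` lies in the subalgebra `R_{i+1}` -/
  r_mem : ∀ (i j : Fin toQSData.n), toQSData.r i j ∈ toQSData.Rsub ((i : ℕ) + 1)
  /-- the defining relations `x_i x_j = q_{ij} x_j x_i + r_{ij}` for `i < j` -/
  rel : ∀ (i j : Fin toQSData.n), i < j → toQSData.x i * toQSData.x j =
    ((toQSData.q i j : Cˣ) : C) • (toQSData.x j * toQSData.x i) + toQSData.r i j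
  /-- `τ_i(x_j) = q_{ij} x_j` for `i < j` -/
  tau_x : ∀ (i j : Fin toQSData.n), i < j → toQSData.τ i (toQSData.x j) =
    ((toQSData.q i j : Cˣ) : C) • toQSData.x j
  /-- `τ_i` preserves `R_{i+1}` -/
  tau_stable : ∀ i : Fin toQSData.n, ∀ a ∈ toQSData.Rsub ((i : ℕ) + 1),
    toQSData.τ i a ∈ toQSData.Rsub ((i : ℕ) + 1)
  /-- `δ_i` maps `R_{i+1}` to itself -/
  delta_stable : ∀ i : Fin toQSData.n, ∀ a ∈ toQSData.Rsub ((i : ℕ) + 1),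
    toQSData.δ i a ∈ toQSData.Rsub ((i : ℕ) + 1)
  /-- Condition Q1: `δ_i τ_i = q_i τ_i δ_i` on `R_{i+1}` -/
  Q1 : ∀ i : Fin toQSData.n, ∀ a ∈ toQSData.Rsub ((i : ℕ) + 1),
    toQSData.δ i (toQSData.τ i a) = ((toQSData.qi i : Cˣ) : C) • toQSData.τ i (toQSData.δ i a)
  /-- Condition Q2: `Γ` is torsionfree -/
  Q2 : TorsionFreeSubgroup toQSData.Γ
  /-- Condition Q3: the monomials are eigenvectors of each `τ_i`, with eigenvalues in `Γ` -/
  Q3 : ∀ (i : Fin toQSData.n) (t : Fin toQSData.n → ℕ) (s : Fin toQSData.m → ℤ), ∃ γ ∈ toQSData.Γ, toQSData.τ i (toQSData.mon t s) = ((γ : Cˣ) : C) • toQSData.mon t s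
  /-- Condition Q4: `R` is a pure `C`-algebra -/
  Q4 : Dense {E : PrimeSpectrum C | QuotDomainFiniteCenter R E.asIdeal}

section OreExtension

variable {B B' : Type*} [Ring B] [Ring B']

theorem exists_mul_eq_mul_right_of_mem_closure {ι : B →+* B'} {X : B'} {S : Set B}
    (hS : IsDenominatorSet S)
    (hX : ∀ s ∈ S, ∃ t ∈ S, ∃ c : B', ι t * X = c * ι s)
    {b : B'} (hb : b ∈ Subring.closure (insert X (Set.range ι))) :
    ∀ s ∈ S, ∃ t ∈ S, ∃ c : B', ι t * b = c * ι s := by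
  induction hb using Subring.closure_induction with
  | mem b hb =>
    rcases hb with rfl | ⟨a, rfl⟩
    · exact hX
    · intro s hs
      obtain ⟨t, ht, c, h⟩ := hS.oreL s hs a
      exact ⟨t, ht, ι c, by rw [← map_mul, h, map_mul]⟩
  | zero => exact fun s hs => ⟨s, hs, 0, by simp⟩
  | one => exact fun s hs => ⟨s, hs, 1, by simp⟩
  | add b₁ b₂ _ _ h₁ h₂ =>
    intro s hs
    obtain ⟨t₁, ht₁, c₁, e₁⟩ := h₁ s hs
    obtain ⟨t₂, ht₂, c₂, e₂⟩ := h₂ s hs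
    obtain ⟨u, hu, d, e⟩ := hS.oreL t₂ ht₂ t₁
    refine ⟨u * t₁, hS.mul_mem u hu t₁ ht₁, ι u * c₁ + ι d * c₂, ?_⟩
    calc ι (u * t₁) * (b₁ + b₂) = ι u * (ι t₁ * b₁) + ι (u * t₁) * b₂ := by
          rw [mul_add, map_mul, mul_assoc]
      _ = (ι u * c₁ + ι d * c₂) * ι s := by
          rw [e, map_mul, mul_assoc, e₁, e₂, add_mul, mul_assoc, mul_assoc]
  | neg b _ h =>
    intro s hs
    obtain ⟨t, ht, c, e⟩ := h s hs
    exact ⟨t, ht, -c, by rw [mul_neg, neg_mul, e]⟩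
  | mul b₁ b₂ _ _ h₁ h₂ =>
    intro s hs
    obtain ⟨t₂, ht₂, c₂, e₂⟩ := h₂ s hs
    obtain ⟨t₁, ht₁, c₁, e₁⟩ := h₁ t₂ ht₂
    exact ⟨t₁, ht₁, c₁ * c₂, by rw [← mul_assoc, e₁, mul_assoc, e₂, mul_assoc]⟩

theorem exists_mul_eq_mul_left_of_mem_closure {ι : B →+* B'} {X : B'} {S : Set B}
    (hS : IsDenominatorSet S)
    (hX : ∀ s ∈ S, ∃ t ∈ S, ∃ c : B', X * ι t = ι s * c)
    {b : B'} (hb : b ∈ Subring.closure (insert X (Set.range ι))) :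
    ∀ s ∈ S, ∃ t ∈ S, ∃ c : B', b * ι t = ι s * c := by
  induction hb using Subring.closure_induction with
  | mem b hb =>
    rcases hb with rfl | ⟨a, rfl⟩
    · exact hX
    · intro s hs
      obtain ⟨t, ht, c, h⟩ := hS.oreR s hs a
      exact ⟨t, ht, ι c, by rw [← map_mul, h, map_mul]⟩
  | zero => exact fun s hs => ⟨s, hs, 0, by simp⟩
  | one => exact fun s hs => ⟨s, hs, 1, by simp⟩
  | add b₁ b₂ _ _ h₁ h₂ =>
    intro s hs
    obtain ⟨t₁, ht₁, c₁, e₁⟩ := h₁ s hs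
    obtain ⟨t₂, ht₂, c₂, e₂⟩ := h₂ s hs
    obtain ⟨u, hu, d, e⟩ := hS.oreR t₂ ht₂ t₁
    refine ⟨t₁ * u, hS.mul_mem t₁ ht₁ u hu, c₁ * ι u + c₂ * ι d, ?_⟩
    calc (b₁ + b₂) * ι (t₁ * u) = b₁ * ι t₁ * ι u + b₂ * ι (t₁ * u) := by
          rw [add_mul, map_mul, mul_assoc]
      _ = ι s * (c₁ * ι u + c₂ * ι d) := by
          rw [e, map_mul, ← mul_assoc b₂, e₁, e₂, mul_add, mul_assoc, mul_assoc]
  | neg b _ h =>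
    intro s hs
    obtain ⟨t, ht, c, e⟩ := h s hs
    exact ⟨t, ht, -c, by rw [mul_neg, neg_mul, e]⟩
  | mul b₁ b₂ _ _ h₁ h₂ =>
    intro s hs
    obtain ⟨t₁, ht₁, c₁, e₁⟩ := h₁ s hs
    obtain ⟨t₂, ht₂, c₂, e₂⟩ := h₂ t₁ ht₁
    exact ⟨t₂, ht₂, c₁ * c₂, by rw [mul_assoc, e₂, ← mul_assoc, e₁, mul_assoc]⟩

end OreExtension

/-- **Lemma 2.2.** Let `B' = B[x; τ, δ]` be a skew (Ore) extension of `B` (the powers of `x`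
form a free basis of `B'` as a left `B`-module and `x a = τ(a) x + δ(a)`), and let `S` be a
multiplicatively closed set of regular elements of `B` satisfying the left and right Ore
conditions in `B` and stable under `τ` and `τ⁻¹`.  Then `S` satisfies the left and right Ore
conditions in `B'`; in particular for every `s ∈ S` and `n > 0` there are `t, t' ∈ S` and
`b, b' ∈ B'` with `t xⁿ = b s` and `xⁿ t' = s b'`. -/
theorem lemma_2_2
    {B B' : Type*} [Ring B] [Ring B']
    (ι : B →+* B') (τ : B ≃+* B) (δ : B →+ B)
    (hLeibniz : ∀ a b : B, δ (a * b) = δ a * b + τ a * δ b)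
    (X : B')
    (hbasis : ∀ c : B', ∃! f : ℕ →₀ B, c = f.sum fun t a => ι a * X ^ t)
    (hskew : ∀ a : B, X * ι a = ι (τ a) * X + ι (δ a))
    (S : Set B) (hS : IsDenominatorSet S)
    (hτS : ∀ s ∈ S, τ s ∈ S ∧ τ.symm s ∈ S) :
    (∀ s ∈ S, ∀ b : B', ∃ t ∈ S, ∃ c : B', ι t * b = c * ι s) ∧
    (∀ s ∈ S, ∀ b : B', ∃ t ∈ S, ∃ c : B', b * ι t = ι s * c) ∧
    (∀ s ∈ S, ∀ n : ℕ, 0 < n →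
      (∃ t ∈ S, ∃ b : B', ι t * X ^ n = b * ι s) ∧
      (∃ t' ∈ S, ∃ b' : B', X ^ n * ι t' = ι s * b')) := by
  have hgen (c : B') : c ∈ Subring.closure (insert X (Set.range ι)) := by
    obtain ⟨f, rfl, -⟩ := hbasis c
    exact sum_mem fun n _ => mul_mem
      (Subring.subset_closure (Set.mem_insert_of_mem _ ⟨f n, rfl⟩))
      (pow_mem (Subring.subset_closure (Set.mem_insert _ _)) n)
  have hXL : ∀ s ∈ S, ∃ t ∈ S, ∃ c : B', ι t * X = c * ι s := by
    intro s hs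
    obtain ⟨u, hu, d, e⟩ := hS.oreL s hs (δ s)
    refine ⟨u * τ s, hS.mul_mem u hu _ (hτS s hs).1, ι u * X - ι d, ?_⟩
    rw [sub_mul, mul_assoc, hskew, ← map_mul ι d, ← e, map_mul, map_mul, mul_add, mul_assoc,
      add_sub_cancel_right]
  have hXR : ∀ s ∈ S, ∃ t ∈ S, ∃ c : B', X * ι t = ι s * c := by
    intro s hs
    obtain ⟨u, hu, d, e⟩ := hS.oreR s hs (δ (τ.symm s))
    refine ⟨τ.symm s * u, hS.mul_mem _ (hτS s hs).2 u hu, X * ι u + ι d, ?_⟩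
    rw [map_mul, ← mul_assoc, hskew, τ.apply_symm_apply, add_mul, ← map_mul ι (δ _), e, map_mul,
      mul_add, mul_assoc]
  have hL (b : B') := exists_mul_eq_mul_right_of_mem_closure hS hXL (hgen b)
  have hR (b : B') := exists_mul_eq_mul_left_of_mem_closure hS hXR (hgen b)
  exact ⟨fun s hs b => hL b s hs, fun s hs b => hR b s hs,
    fun s hs n _ => ⟨hL (X ^ n) s hs, hR (X ^ n) s hs⟩⟩

end Panov
end
end

section
/- Let A be a division ring whose center contains a field F of characteristic 0, let τ be an F-linear ring automorphism of A and δ an F-linear τ-derivation of A, and let A' = A[x; τ, δ] be the Ore extension (the powers of x form a free left A-basis of A' and xa = τ(a)x + δ(a) for a ∈ A). Assume the extension is q-skew, i.e. δτ = q τδ for some q ∈ F^* that is not a root of unity, and assume δ is not an inner τ-derivation of A (there is no r ∈ A with δ(a) = τ(a)r − ra for all a ∈ A). Then the ring A' is simple, i.e. its only two-sided ideals are 0 and A'. -/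
/- Common definitions for the formalization of
   "Stratification of prime spectrum of quantum solvable algebras" (A. N. Panov). -/

noncomputable section

namespace Panov

variable {R : Type*}

section OreExtension

variable {A A' : Type*} [DivisionRing A] [Ring A']

/-- The additive map sending a finitely supported family `f` of left coefficients to
`∑ t, ι (f t) * X ^ t`. -/
def oreSum (ι : A →+* A') (X : A') : (ℕ →₀ A) →+ A' :=
  Finsupp.liftAddHom fun t => (AddMonoidHom.mulRight (X ^ t)).comp ι.toAddMonoidHom

theorem oreSum_apply (ι : A →+* A') (X : A') (f : ℕ →₀ A) :
    oreSum ι X f = f.sum fun t a => ι a * X ^ t := rfl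

theorem oreSum_single (ι : A →+* A') (X : A') (t : ℕ) (a : A) :
    oreSum ι X (Finsupp.single t a) = ι a * X ^ t := by
  simp [oreSum]

theorem oreSum_bijective {ι : A →+* A'} {X : A'}
    (hbasis : ∀ c : A', ∃! f : ℕ →₀ A, c = f.sum fun t a => ι a * X ^ t) :
    Function.Bijective (oreSum ι X) := by
  refine ⟨fun f g h => ?_, fun c => ?_⟩
  · exact (hbasis (oreSum ι X f)).unique rfl h
  · obtain ⟨f, hf, -⟩ := hbasis c
    exact ⟨f, hf.symm⟩

/-- The coefficient of `X ^ t` when the powers of `X` form a left basis. -/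
def oreCoeff {ι : A →+* A'} {X : A'} (h : Function.Bijective (oreSum ι X)) (t : ℕ) : A' →+ A :=
  (Finsupp.applyAddHom t).comp (AddEquiv.ofBijective (oreSum ι X) h).symm.toAddMonoidHom

variable {ι : A →+* A'} {X : A'} (h : Function.Bijective (oreSum ι X))

theorem oreCoeff_oreSum (t : ℕ) (f : ℕ →₀ A) : oreCoeff h t (oreSum ι X f) = f t := by
  change (AddEquiv.ofBijective (oreSum ι X) h).symm
    (AddEquiv.ofBijective (oreSum ι X) h f) t = f t
  rw [AddEquiv.symm_apply_apply]

theorem oreCoeff_monomial (t s : ℕ) (a : A) :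
    oreCoeff h t (ι a * X ^ s) = Finsupp.single s a t := by
  rw [← oreSum_single, oreCoeff_oreSum]

theorem eq_zero_of_oreCoeff {c : A'} (hc : ∀ t, oreCoeff h t c = 0) : c = 0 := by
  obtain ⟨f, rfl⟩ := h.2 c
  have : f = 0 := by
    ext t
    simpa [oreCoeff_oreSum] using hc t
  rw [this, map_zero]

theorem oreCoeff_coe_mul (t : ℕ) (a : A) (c : A') :
    oreCoeff h t (ι a * c) = a * oreCoeff h t c := by
  obtain ⟨f, rfl⟩ := h.2 c
  induction f using Finsupp.induction_linear with
  | zero => simp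
  | add f g hf hg => simp only [map_add, mul_add, hf, hg]
  | single s b =>
    rw [oreSum_single, ← mul_assoc, ← map_mul, oreCoeff_monomial, oreCoeff_monomial]
    rw [Finsupp.single_apply, Finsupp.single_apply, mul_ite, mul_zero]

theorem oreCoeff_sum_mul (t : ℕ) (f : ℕ →₀ A) (y : A') :
    oreCoeff h t (oreSum ι X f * y) = f.sum fun s b => b * oreCoeff h t (X ^ s * y) := by
  rw [oreSum_apply, Finsupp.sum, Finset.sum_mul, map_sum]
  exact Finset.sum_congr rfl fun s _ => by rw [mul_assoc, oreCoeff_coe_mul]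

theorem oreCoeff_succ_X_mul {τ δ : A →+ A}
    (hskew : ∀ a : A, X * ι a = ι (τ a) * X + ι (δ a)) (t : ℕ) (c : A') :
    oreCoeff h (t + 1) (X * c) = τ (oreCoeff h t c) + δ (oreCoeff h (t + 1) c) := by
  obtain ⟨f, rfl⟩ := h.2 c
  induction f using Finsupp.induction_linear with
  | zero => simp
  | add f g hf hg =>
    simp only [map_add, mul_add, hf, hg]
    abel
  | single s b =>
    rw [oreSum_single, ← mul_assoc, hskew, add_mul, mul_assoc, ← pow_succ', map_add]
    simp only [oreCoeff_monomial, Finsupp.single_apply, Nat.add_right_cancel_iff]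
    split_ifs <;> simp

theorem oreCoeff_X_pow_mul_of_lt {τ δ : A →+ A}
    (hskew : ∀ a : A, X * ι a = ι (τ a) * X + ι (δ a)) (a : A) (n t : ℕ) (hnt : n < t) :
    oreCoeff h t (X ^ n * ι a) = 0 := by
  induction n generalizing t with
  | zero =>
    have := oreCoeff_monomial h t 0 a
    simpa [Finsupp.single_apply, hnt.ne] using this
  | succ n ih =>
    obtain ⟨t, rfl⟩ : ∃ k, t = k + 1 := ⟨t - 1, by omega⟩
    rw [pow_succ', mul_assoc, oreCoeff_succ_X_mul h hskew, ih t (by omega),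
      ih (t + 1) (by omega), map_zero, map_zero, add_zero]

theorem oreCoeff_X_pow_mul_self {τ δ : A →+ A}
    (hskew : ∀ a : A, X * ι a = ι (τ a) * X + ι (δ a)) (a : A) (n : ℕ) :
    oreCoeff h n (X ^ n * ι a) = τ^[n] a := by
  induction n with
  | zero =>
    have := oreCoeff_monomial h 0 0 a
    simpa using this
  | succ n ih =>
    rw [pow_succ', mul_assoc, oreCoeff_succ_X_mul h hskew, ih,
      oreCoeff_X_pow_mul_of_lt h hskew a n (n + 1) n.lt_succ_self, map_zero, add_zero,
      Function.iterate_succ_apply']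

theorem oreCoeff_zero_X_mul {τ δ : A →+ A}
    (hskew : ∀ a : A, X * ι a = ι (τ a) * X + ι (δ a)) (c : A') :
    oreCoeff h 0 (X * c) = δ (oreCoeff h 0 c) := by
  obtain ⟨f, rfl⟩ := h.2 c
  induction f using Finsupp.induction_linear with
  | zero => simp
  | add f g hf hg => simp only [map_add, mul_add, hf, hg]
  | single s b =>
    rw [oreSum_single, ← mul_assoc, hskew, add_mul, mul_assoc, ← pow_succ', map_add]
    simp only [oreCoeff_monomial, Finsupp.single_apply]
    split_ifs <;> simp_all

theorem iterate_skew {F : Type*} [Field F] [Algebra F A] {τ : A ≃ₐ[F] A} {δ : A →ₗ[F] A}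
    {q : F} (hqskew : ∀ a : A, δ (τ a) = q • τ (δ a)) (n : ℕ) (a : A) :
    δ (τ^[n] a) = q ^ n • τ^[n] (δ a) := by
  induction n with
  | zero => simp
  | succ n ih =>
    rw [Function.iterate_succ_apply', hqskew, ih, map_smul, smul_smul, ← pow_succ',
      Function.iterate_succ_apply']

theorem oreCoeff_X_pow_succ_mul {F : Type*} [Field F] [Algebra F A] {τ : A ≃ₐ[F] A}
    {δ : A →ₗ[F] A} {q : F} (hskew : ∀ a : A, X * ι a = ι (τ a) * X + ι (δ a))
    (hqskew : ∀ a : A, δ (τ a) = q • τ (δ a)) (a : A) (n : ℕ) :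
    oreCoeff h n (X ^ (n + 1) * ι a) =
      (∑ i ∈ Finset.range (n + 1), q ^ i) • τ^[n] (δ a) := by
  have hs : ∀ a : A, X * ι a = ι ((τ : A →+ A) a) * X + ι (δ.toAddMonoidHom a) := hskew
  induction n with
  | zero =>
    have h0 := oreCoeff_X_pow_mul_self h hs a 0
    rw [pow_succ', mul_assoc, oreCoeff_zero_X_mul h hs, h0]
    simp
  | succ n ih =>
    rw [pow_succ', mul_assoc, oreCoeff_succ_X_mul h hs, ih, oreCoeff_X_pow_mul_self h hs,
      Finset.sum_range_succ _ (n + 1), add_smul]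
    have h1 := iterate_skew hqskew (n + 1) a
    have h2 : (⇑(τ : A →+ A)) = ⇑τ := rfl
    rw [h2]
    refine congrArg₂ (· + ·) ?_ h1
    rw [map_smul, Function.iterate_succ_apply']

theorem oreCoeff_mul_of_degree_le {c : A'} {n : ℕ}
    (hc : ∀ t, n < t → oreCoeff h t c = 0) (a : A) (m : ℕ) :
    oreCoeff h m (c * ι a) =
      ∑ s ∈ Finset.range (n + 1), oreCoeff h s c * oreCoeff h m (X ^ s * ι a) := by
  obtain ⟨f, rfl⟩ := h.2 c
  simp only [oreCoeff_oreSum] at hc ⊢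
  rw [oreCoeff_sum_mul, Finsupp.sum_of_support_subset _ _ _ (by simp)]
  intro s hs
  rw [Finset.mem_range]
  by_contra hlt
  exact Finsupp.mem_support_iff.1 hs (hc s (by omega))

/-- A nonzero two-sided ideal contains a monic element of
minimal degree, and this element skew-commutes with the coefficients. -/
theorem exists_monic_skew_commuting {τ δ : A →+ A}
    (hskew : ∀ a : A, X * ι a = ι (τ a) * X + ι (δ a)) {I : TwoSidedIdeal A'} (hI : I ≠ ⊥) :
    ∃ n, ∃ c ∈ I, oreCoeff h n c = 1 ∧ (∀ t, n < t → oreCoeff h t c = 0) ∧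
      ∀ a, c * ι a = ι (τ^[n] a) * c := by
  classical
  have hex : ∃ n, ∃ c ∈ I, c ≠ 0 ∧ ∀ t, n ≤ t → oreCoeff h t c = 0 := by
    obtain ⟨c, hcI, hc⟩ : ∃ c ∈ I, c ≠ 0 := by
      by_contra! hcon
      exact hI (le_bot_iff.1 fun x hx => (TwoSidedIdeal.mem_bot A').2 (hcon x hx))
    obtain ⟨f, rfl⟩ := h.2 c
    obtain ⟨N, hN⟩ := f.support.exists_nat_subset_range
    refine ⟨N, _, hcI, hc, fun t ht => ?_⟩
    rw [oreCoeff_oreSum]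
    by_contra hne
    have := Finset.mem_range.1 (hN (Finsupp.mem_support_iff.2 hne))
    omega
  obtain ⟨c, hcI, hc, hdeg⟩ := Nat.find_spec hex
  have hmin := fun m => Nat.find_min (m := m) hex
  generalize Nat.find hex = N at hdeg hmin
  obtain ⟨n, rfl⟩ : ∃ n, N = n + 1 := by
    refine Nat.exists_eq_succ_of_ne_zero ?_
    rintro rfl
    exact hc (eq_zero_of_oreCoeff h fun t => hdeg t t.zero_le)
  have hlead : oreCoeff h n c ≠ 0 := by
    intro h0
    refine hmin n n.lt_succ_self ⟨c, hcI, hc, fun t ht => ?_⟩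
    rcases ht.eq_or_lt with rfl | ht
    exacts [h0, hdeg t ht]
  obtain ⟨d, hdI, hd1, hd⟩ : ∃ d ∈ I, oreCoeff h n d = 1 ∧ ∀ t, n < t → oreCoeff h t d = 0 := by
    refine ⟨ι (oreCoeff h n c)⁻¹ * c, I.mul_mem_left _ _ hcI, ?_, fun t ht => ?_⟩
    · rw [oreCoeff_coe_mul, inv_mul_cancel₀ hlead]
    · rw [oreCoeff_coe_mul, hdeg t ht, mul_zero]
  refine ⟨n, d, hdI, hd1, hd, fun a => ?_⟩
  by_contra hne
  refine hmin n n.lt_succ_self ⟨d * ι a - ι (τ^[n] a) * d,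
    I.sub_mem (I.mul_mem_right _ _ hdI) (I.mul_mem_left _ _ hdI), sub_ne_zero.2 hne,
    fun t ht => ?_⟩
  have hlow : ∑ s ∈ Finset.range n, oreCoeff h s d * oreCoeff h t (X ^ s * ι a) = 0 :=
    Finset.sum_eq_zero fun s hs => by
      rw [oreCoeff_X_pow_mul_of_lt h hskew a s t ((Finset.mem_range.1 hs).trans_le ht), mul_zero]
  rw [map_sub, oreCoeff_mul_of_degree_le h hd, oreCoeff_coe_mul, Finset.sum_range_succ,
    hlow, hd1, zero_add, one_mul]
  rcases ht.eq_or_lt with rfl | ht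
  · rw [oreCoeff_X_pow_mul_self h hskew, hd1, mul_one, sub_self]
  · rw [oreCoeff_X_pow_mul_of_lt h hskew a n t ht, hd t ht, mul_zero, sub_self]

end OreExtension

/-- **Lemma 2.3.** Let `A` be a division algebra over a field `F` of characteristic `0`, and
let `A' = A[x; τ, δ]` be a `q`-skew Ore extension (`δτ = qτδ` with `q ∈ F^*` not a root of
unity).  If `δ` is not an inner `τ`-derivation of `A`, then the ring `A'` is simple. -/
theorem lemma_2_3
    {F : Type*} [Field F] [CharZero F]
    {A : Type*} [DivisionRing A] [Algebra F A]
    {A' : Type*} [Ring A'] (ι : A →+* A') (X : A')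
    (τ : A ≃ₐ[F] A) (δ : A →ₗ[F] A)
    (hLeibniz : ∀ a b : A, δ (a * b) = δ a * b + τ a * δ b)
    (hbasis : ∀ c : A', ∃! f : ℕ →₀ A, c = f.sum fun t a => ι a * X ^ t)
    (hskew : ∀ a : A, X * ι a = ι (τ a) * X + ι (δ a))
    (q : F) (hq0 : q ≠ 0) (hqroot : ∀ t : ℕ, 0 < t → q ^ t ≠ 1)
    (hqskew : ∀ a : A, δ (τ a) = q • τ (δ a))
    (hnotinner : ¬ ∃ r : A, ∀ a : A, δ a = τ a * r - r * a) :
    ∀ I : TwoSidedIdeal A', I = ⊥ ∨ I = ⊤ := by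
  intro I
  refine or_iff_not_imp_left.2 fun hI => ?_
  have h := oreSum_bijective hbasis
  have hs : ∀ a : A, X * ι a = ι ((τ : A →+ A) a) * X + ι (δ.toAddMonoidHom a) := hskew
  obtain ⟨n, c, hcI, hc1, hdeg, hcomm⟩ := exists_monic_skew_commuting h hs hI
  have hτ : (⇑(τ : A →+ A)) = ⇑τ := rfl
  rw [hτ] at hcomm
  cases n with
  | zero =>
    have hc : c = 1 := by
      refine sub_eq_zero.1 (eq_zero_of_oreCoeff h fun t => ?_)
      have h1 := oreCoeff_monomial h t 0 1
      rw [map_one, pow_zero, one_mul] at h1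
      rw [map_sub, h1]
      rcases t.eq_zero_or_pos with rfl | ht
      · simp [hc1]
      · simp [hdeg t ht, ht.ne]
    exact (TwoSidedIdeal.one_mem_iff I).1 (hc ▸ hcI)
  | succ n =>
    refine absurd ?_ hnotinner
    set k : F := ∑ i ∈ Finset.range (n + 1), q ^ i with hk
    have hk0 : k ≠ 0 := by
      intro h0
      have := geom_sum_mul q (n + 1)
      rw [← hk, h0, zero_mul] at this
      exact hqroot (n + 1) n.succ_pos (sub_eq_zero.1 this.symm)
    obtain ⟨b, hb⟩ := τ.surjective.iterate n (oreCoeff h n c)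
    have key : ∀ a, k • δ a = τ a * b - b * a := by
      intro a
      have h1 := congrArg (oreCoeff h n) (hcomm a)
      have hlow : ∑ s ∈ Finset.range n, oreCoeff h s c * oreCoeff h n (X ^ s * ι a) = 0 :=
        Finset.sum_eq_zero fun s hs' => by
          rw [oreCoeff_X_pow_mul_of_lt h hs a s n (Finset.mem_range.1 hs'), mul_zero]
      rw [oreCoeff_mul_of_degree_le h hdeg, oreCoeff_coe_mul, Finset.sum_range_succ,
        Finset.sum_range_succ, hlow, hc1, zero_add, one_mul, oreCoeff_X_pow_mul_self h hs,
        oreCoeff_X_pow_succ_mul h hskew hqskew, ← hk, ← hb, hτ,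
        Function.iterate_succ_apply] at h1
      apply τ.injective.iterate n
      rw [← AlgEquiv.coe_pow] at h1 ⊢
      rw [map_smul, map_sub, map_mul, map_mul, ← h1, add_sub_cancel_left]
    refine ⟨k⁻¹ • b, fun a => ?_⟩
    rw [mul_smul_comm, smul_mul_assoc, ← smul_sub, ← key, inv_smul_smul₀ hk0]

end Panov
end
end

section
/- Let B be a C-algebra which is a Noetherian semiprime ring with minimal prime ideals Q_1,…,Q_s, all of which are completely prime and such that each B/Q_j is pure quantum. Suppose B is generated over C by elements x_1,…,x_n, k_1^{±1},…,k_m^{±1} with x_n ≠ 0, where the k_j q-commute with all generators, for i < j one has x_i x_j = q_{ij} x_j x_i + r_{ij} with q_{ij} invertible in C and r_{ij} in the subalgebra B_{i+1} generated by x_{i+1},…,x_n, k_1^{±1},…,k_m^{±1}, suppose x_n ∉ Q_j for all j, and suppose B admits a diagonal action of a group H (the generators are H-eigenvectors with eigenvalues generating a torsionfree subgroup Γ of C^*). Then x_n is a regular element of B and the multiplicatively closed set generated by x_n is a denominator (two-sided Ore) set in B. -/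
/- Common definitions for the formalization of
   "Stratification of prime spectrum of quantum solvable algebras" (A. N. Panov). -/

noncomputable section

namespace Panov

variable {R : Type*}

/-- A two-sided ideal has zero intersection with `C`. -/
def ZeroInter (C : Type*) {R : Type*} [CommRing C] [Ring R] [Algebra C R]
    (P : TwoSidedIdeal R) : Prop :=
  ∀ c : C, algebraMap C R c ∈ P → c = 0

/-- The subalgebra of all `b` such that for every `t` some left multiple `x ^ N * b` lies in
`B x ^ t`; the left Ore condition holds for the powers of `x` exactly when it is everything. -/
def leftOreSubalgebra (C : Type*) {B : Type*} [CommRing C] [Ring B] [Algebra C B] (x : B) :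
    Subalgebra C B where
  carrier := {b | ∀ t : ℕ, ∃ (N : ℕ) (c : B), x ^ N * b = c * x ^ t}
  mul_mem' := by
    intro a b ha hb t
    obtain ⟨M, c, hc⟩ := hb t
    obtain ⟨N, d, hd⟩ := ha M
    exact ⟨N, d * c, by rw [← mul_assoc, hd, mul_assoc, hc, mul_assoc]⟩
  add_mem' := by
    intro a b ha hb t
    obtain ⟨M, c, hc⟩ := hb t
    obtain ⟨N, d, hd⟩ := ha t
    refine ⟨M + N, x ^ M * d + x ^ N * c, ?_⟩
    rw [mul_add, add_mul, mul_assoc, mul_assoc, ← hc, ← hd, ← mul_assoc, ← mul_assoc,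
      ← pow_add, ← pow_add, add_comm N M]
  algebraMap_mem' := fun c t => ⟨t, algebraMap C B c, (Algebra.commutes c _).symm⟩

theorem mem_leftOreSubalgebra {C B : Type*} [CommRing C] [Ring B] [Algebra C B] {x b : B} :
    b ∈ leftOreSubalgebra C x ↔ ∀ t : ℕ, ∃ (N : ℕ) (c : B), x ^ N * b = c * x ^ t :=
  Iff.rfl

theorem mem_leftOreSubalgebra_of_mul_eq {C B : Type*} [CommRing C] [Ring B] [Algebra C B]
    {x y r : B} (u : C) (h : x * y = u • (y * x) + r) (hr : r ∈ leftOreSubalgebra C x) :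
    y ∈ leftOreSubalgebra C x := by
  intro t
  induction t with
  | zero => exact ⟨0, y, by simp⟩
  | succ t ih =>
    obtain ⟨N, c, hc⟩ := ih
    obtain ⟨K, d, hd⟩ := hr (t + 1)
    refine ⟨N + K + 1, u • (x ^ K * c) + x ^ N * d, ?_⟩
    calc x ^ (N + K + 1) * y
        = x ^ (N + K) * (u • (y * x) + r) := by rw [pow_succ, mul_assoc, h]
      _ = u • (x ^ K * (x ^ N * y) * x) + x ^ N * (x ^ K * r) := by
        rw [mul_add, mul_smul_comm, ← mul_assoc (x ^ K) (x ^ N), ← mul_assoc (x ^ N) (x ^ K),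
          ← pow_add, ← pow_add, add_comm K N, mul_assoc _ y x]
      _ = (u • (x ^ K * c) + x ^ N * d) * x ^ (t + 1) := by
        rw [hc, hd, add_mul, smul_mul_assoc, pow_succ]
        simp only [mul_assoc]

theorem mem_leftOreSubalgebra_of_mul_eq_smul {C B : Type*} [CommRing C] [Ring B] [Algebra C B]
    {x y : B} (u : C) (h : x * y = u • (y * x)) : y ∈ leftOreSubalgebra C x :=
  mem_leftOreSubalgebra_of_mul_eq u (r := 0) (by rw [h, add_zero]) (zero_mem _)

theorem self_mem_leftOreSubalgebra {C B : Type*} [CommRing C] [Ring B] [Algebra C B] (x : B) :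
    x ∈ leftOreSubalgebra C x :=
  mem_leftOreSubalgebra_of_mul_eq_smul 1 (by rw [one_smul])

theorem mul_eq_inv_smul_of_mul_eq_smul {C B : Type*} [CommRing C] [Ring B] [Algebra C B]
    {a b : B} (u : Cˣ) (h : a * b = (u : C) • (b * a)) :
    b * a = ((u⁻¹ : Cˣ) : C) • (a * b) := by
  rw [h, smul_smul, Units.inv_mul, one_smul]

theorem inv_mul_eq_inv_smul_of_mul_eq_smul {C B : Type*} [CommRing C] [Ring B] [Algebra C B]
    {b : B} (k : Bˣ) (u : Cˣ) (h : (k : B) * b = (u : C) • (b * k)) :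
    ((k⁻¹ : Bˣ) : B) * b = ((u⁻¹ : Cˣ) : C) • (b * ((k⁻¹ : Bˣ) : B)) := by
  have h2 := congrArg (fun z => ((k⁻¹ : Bˣ) : B) * z * ((k⁻¹ : Bˣ) : B))
    (mul_eq_inv_smul_of_mul_eq_smul u h)
  simpa [mul_assoc] using h2

theorem generators_mem_of_remainders {C B : Type*} [CommRing C] [Ring B] [Algebra C B]
    {n : ℕ} (x : Fin (n + 1) → B) (K : Set B) (r : Fin (n + 1) → B)
    (hr : ∀ i : Fin (n + 1), r i ∈ Algebra.adjoin C
      ((x '' {l : Fin (n + 1) | (i : ℕ) + 1 ≤ (l : ℕ)}) ∪ K))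
    (A : Subalgebra C B) (hlast : x (Fin.last n) ∈ A) (hK : K ⊆ A)
    (hstep : ∀ i < Fin.last n, r i ∈ A → x i ∈ A) (i : Fin (n + 1)) : x i ∈ A := by
  induction i using WellFoundedGT.induction with
  | _ i ih =>
    rcases (Fin.le_last i).eq_or_lt with rfl | hi
    · exact hlast
    · refine hstep i hi (Algebra.adjoin_le (Set.union_subset ?_ hK) (hr i))
      rintro _ ⟨l, hl, rfl⟩
      exact ih l (Fin.lt_def.mpr hl)

theorem isRegular_of_notMem_completelyPrime {B : Type*} [Ring B] {ι : Type*}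
    (Q : ι → TwoSidedIdeal B) (hQ : ∀ j, IsCompletelyPrimeTS (Q j)) (hbot : ⨅ j, Q j = ⊥)
    {x : B} (hx : ∀ j, x ∉ Q j) : IsRegular x := by
  have key : ∀ b : B, (∀ j, b ∈ Q j) → b = 0 := by
    intro b hb
    rw [← TwoSidedIdeal.mem_bot, ← hbot, TwoSidedIdeal.mem_iInf]
    exact hb
  rw [isRegular_iff_eq_zero_of_mul]
  refine ⟨fun b hb => key b fun j => ?_, fun b hb => key b fun j => ?_⟩
  · exact ((hQ j).2 x b (hb ▸ zero_mem _)).resolve_left (hx j)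
  · exact ((hQ j).2 b x (hb ▸ zero_mem _)).resolve_right (hx j)

theorem isDenominatorSet_powers {C B : Type*} [CommRing C] [Ring B] [Algebra C B] {x : B}
    (hreg : IsRegular x) (hL : leftOreSubalgebra C x = ⊤)
    (hR : leftOreSubalgebra C (MulOpposite.op x) = ⊤) :
    IsDenominatorSet {b : B | ∃ t : ℕ, b = x ^ t} where
  one_mem := ⟨0, (pow_zero x).symm⟩
  mul_mem := by
    rintro _ ⟨a, rfl⟩ _ ⟨b, rfl⟩
    exact ⟨a + b, (pow_add x a b).symm⟩
  regular := by
    rintro _ ⟨a, rfl⟩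
    exact hreg.pow a
  oreL := by
    rintro _ ⟨a, rfl⟩ b
    obtain ⟨N, c, h⟩ := mem_leftOreSubalgebra.mp (hL ▸ Algebra.mem_top (x := b)) a
    exact ⟨x ^ N, ⟨N, rfl⟩, c, h⟩
  oreR := by
    rintro _ ⟨a, rfl⟩ b
    obtain ⟨N, c, h⟩ :=
      mem_leftOreSubalgebra.mp (hR ▸ Algebra.mem_top (x := MulOpposite.op b)) a
    exact ⟨x ^ N, ⟨N, rfl⟩, c.unop, by simpa using congrArg MulOpposite.unop h⟩

/-- **Lemma 3.3(1).** Let `B` be a Noetherian semiprime `C`-algebra whose minimal prime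
ideals `Q₁, …, Q_s` are completely prime with each `B/Q_j` pure quantum.  Suppose `B` is
generated over `C` by `x₁, …, x_{n+1}, k₁^{±1}, …, k_m^{±1}` subject to solvable-type
relations, with `x_{n+1} ≠ 0`, `x_{n+1} ∉ Q_j` for all `j`, and that `B` admits a diagonal
`H`-action whose eigenvalues generate a torsionfree subgroup `Γ ⊆ C^*`.  Then the last
generator is regular and the multiplicative set of its powers is a denominator set. -/
theorem lemma_3_3_part1
    {C : Type*} [CommRing C] [IsDomain C] [IsNoetherianRing C] [CharZero C]
    {B : Type*} [Ring B] [Algebra C B] [IsNoetherianRing B]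
    {s : ℕ} (Qs : Fin s → TwoSidedIdeal B)
    (hQprime : ∀ j, IsPrimeTS (Qs j))
    (hQcp : ∀ j, IsCompletelyPrimeTS (Qs j))
    (hQmin : ∀ j, ∀ Q' : TwoSidedIdeal B, IsPrimeTS Q' → Q' ≤ Qs j → Q' = Qs j)
    (hsemiprime : (⨅ j, Qs j) = (⊥ : TwoSidedIdeal B))
    (hminimal : ∀ Q' : TwoSidedIdeal B, IsPrimeTS Q' →
      (∀ Q'' : TwoSidedIdeal B, IsPrimeTS Q'' → Q'' ≤ Q' → Q'' = Q') → ∃ j, Q' = Qs j)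
    (hpure : ∀ j, PureQuantum (Qs j).ringCon.Quotient)
    {n m : ℕ} (x : Fin (n + 1) → B) (k : Fin m → Bˣ)
    (hgen : Algebra.adjoin C (Set.range x ∪
      ((Set.range fun j => ((k j : B))) ∪ (Set.range fun j => (((k j)⁻¹ : Bˣ) : B)))) = ⊤)
    (qk : Fin m → Fin (n + 1) → Cˣ)
    (hkx : ∀ j i, ((k j : B)) * x i = ((qk j i : Cˣ) : C) • (x i * (k j : B)))
    (qkk : Fin m → Fin m → Cˣ)
    (hkk : ∀ j j', ((k j : B)) * (k j' : B) = ((qkk j j' : Cˣ) : C) • ((k j' : B) * (k j : B)))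
    (q : Fin (n + 1) → Fin (n + 1) → Cˣ) (r : Fin (n + 1) → Fin (n + 1) → B)
    (hrmem : ∀ i j : Fin (n + 1), r i j ∈ Algebra.adjoin C
      ((x '' {l : Fin (n + 1) | (i : ℕ) + 1 ≤ (l : ℕ)}) ∪
        ((Set.range fun j => ((k j : B))) ∪ (Set.range fun j => (((k j)⁻¹ : Bˣ) : B)))))
    (hrel : ∀ i j : Fin (n + 1), i < j →
      x i * x j = ((q i j : Cˣ) : C) • (x j * x i) + r i j)
    (hxn0 : x (Fin.last n) ≠ 0)
    (hxnQ : ∀ j, x (Fin.last n) ∉ Qs j)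
    {H : Type*} [CommGroup H] (ρ : H →* (B ≃ₐ[C] B))
    (lamx : Fin (n + 1) → H → Cˣ) (lamk : Fin m → H → Cˣ)
    (hx : ∀ (i : Fin (n + 1)) (h : H), ρ h (x i) = ((lamx i h : Cˣ) : C) • x i)
    (hk : ∀ (j : Fin m) (h : H), ρ h ((k j : B)) = ((lamk j h : Cˣ) : C) • ((k j : B)))
    (hΓ : TorsionFreeSubgroup (Subgroup.closure
      ((Set.range fun p : Fin (n + 1) × H => lamx p.1 p.2) ∪
        (Set.range fun p : Fin m × H => lamk p.1 p.2)))) :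
    IsRegular (x (Fin.last n)) ∧
      IsDenominatorSet {b : B | ∃ t : ℕ, b = x (Fin.last n) ^ t} := by
  have hreg := isRegular_of_notMem_completelyPrime Qs hQcp hsemiprime hxnQ
  set z := x (Fin.last n)
  have htop : ∀ A : Subalgebra C B, z ∈ A →
      (∀ j, ((k j : B)) ∈ A) → (∀ j, (((k j)⁻¹ : Bˣ) : B) ∈ A) →
      (∀ i < Fin.last n, r i (Fin.last n) ∈ A → x i ∈ A) → A = ⊤ := by
    intro A hzA hkA hkA' hstep
    have hK : (Set.range fun j => ((k j : B))) ∪ (Set.range fun j => (((k j)⁻¹ : Bˣ) : B)) ⊆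
        (A : Set B) :=
      Set.union_subset (Set.range_subset_iff.mpr hkA) (Set.range_subset_iff.mpr hkA')
    have hxA := generators_mem_of_remainders x _ (fun i => r i (Fin.last n))
      (fun i => hrmem i (Fin.last n)) A hzA hK hstep
    rw [eq_top_iff, ← hgen]
    exact Algebra.adjoin_le (Set.union_subset (Set.range_subset_iff.mpr hxA) hK)
  have hkz := fun j => hkx j (Fin.last n)
  have hkz' := fun j => inv_mul_eq_inv_smul_of_mul_eq_smul (k j) _ (hkz j)
  refine ⟨hreg, isDenominatorSet_powers (C := C) hreg ?_ ?_⟩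
  · refine htop _ (self_mem_leftOreSubalgebra z)
      (fun j => mem_leftOreSubalgebra_of_mul_eq_smul _
        (mul_eq_inv_smul_of_mul_eq_smul _ (hkz j)))
      (fun j => mem_leftOreSubalgebra_of_mul_eq_smul _
        (mul_eq_inv_smul_of_mul_eq_smul _ (hkz' j)))
      fun i hi hri => mem_leftOreSubalgebra_of_mul_eq (((q i (Fin.last n))⁻¹ : Cˣ) : C)
        (r := -((((q i (Fin.last n))⁻¹ : Cˣ) : C) • r i (Fin.last n))) ?_
        (neg_mem (Subalgebra.smul_mem _ hri _))
    rw [hrel i _ hi, smul_add, smul_smul, Units.inv_mul, one_smul, add_neg_cancel_right]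
  · have h := htop (leftOreSubalgebra C (MulOpposite.op z)).unop
      (self_mem_leftOreSubalgebra (C := C) (MulOpposite.op z))
      (fun j => mem_leftOreSubalgebra_of_mul_eq_smul (x := MulOpposite.op z)
        (y := MulOpposite.op (k j : B)) ((qk j (Fin.last n) : Cˣ) : C)
        (congrArg MulOpposite.op (hkz j)))
      (fun j => mem_leftOreSubalgebra_of_mul_eq_smul (x := MulOpposite.op z)
        (y := MulOpposite.op (((k j)⁻¹ : Bˣ) : B)) (((qk j (Fin.last n))⁻¹ : Cˣ) : C)
        (congrArg MulOpposite.op (hkz' j)))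
      (fun i hi hri => mem_leftOreSubalgebra_of_mul_eq (x := MulOpposite.op z)
        (y := MulOpposite.op (x i)) (r := MulOpposite.op (r i (Fin.last n)))
        ((q i (Fin.last n) : Cˣ) : C) (congrArg MulOpposite.op (hrel i _ hi)) hri)
    exact eq_top_iff.mpr fun b _ => (h ▸ Algebra.mem_top :
      b.unop ∈ (leftOreSubalgebra C (MulOpposite.op z)).unop)

end Panov
end
end

section
/- Let B = C_Q[x_1^{±1},…,x_n^{±1}] be the algebra of twisted Laurent polynomials over a commutative Noetherian domain C, with relations x_i x_j = q_{ij} x_j x_i where the q_{ij} ∈ C^* satisfy q_{ij}q_{ji} = q_{ii} = 1, and suppose the subgroup Γ of C^* generated by the q_{ij} is torsionfree. Then the center of B is spanned over C by the monomials x_1^{m_1}⋯x_n^{m_n} whose exponent vector (m_1,…,m_n) ∈ ℤ^n satisfies q_{i1}^{m_1}⋯q_{in}^{m_n} = 1 for all i = 1,…,n; moreover the set G of such exponent vectors is a subgroup of ℤ^n, and there exists a new set of pairwise q-commuting generators Y_1^{±1},…,Y_n^{±1} of B such that the center of B is generated by Y_{m+1}^{±1},…,Y_n^{±1} for some m. 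-/
/- Common definitions for the formalization of
   "Stratification of prime spectrum of quantum solvable algebras" (A. N. Panov). -/

noncomputable section

namespace Panov

variable {R : Type*}

section Monomials

variable {G K : Type*} [Group G] [CommGroup K] {N : ℕ}

/-- The ordered Laurent monomial with exponent vector `a` in elements of a group. -/
def groupMon (x : Fin N → G) (a : Fin N → ℤ) : G :=
  ((List.finRange N).map fun i => x i ^ a i).prod

theorem coe_groupMon {B : Type*} [Monoid B] (x : Fin N → Bˣ) (a : Fin N → ℤ) :
    ((groupMon x a : Bˣ) : B) = lmon x a := by
  rw [groupMon, lmon, ← Units.coeHom_apply, map_list_prod, List.map_map]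
  rfl

theorem map_groupMon {H : Type*} [Group H] (φ : G →* H) (x : Fin N → G) (a : Fin N → ℤ) :
    φ (groupMon x a) = groupMon (fun i => φ (x i)) a := by
  rw [groupMon, groupMon, map_list_prod, List.map_map]
  congr 2
  funext i
  exact map_zpow φ _ _

@[simp]
theorem groupMon_zero (x : Fin N → G) : groupMon x 0 = 1 := by
  simp [groupMon]

theorem list_prod_zpow_add {ι : Type*} (x : ι → G) (hx : ∀ i j, Commute (x i) (x j))
    (a b : ι → ℤ) (l : List ι) :
    (l.map fun i => x i ^ (a i + b i)).prod =
      (l.map fun i => x i ^ a i).prod * (l.map fun i => x i ^ b i).prod := by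
  induction l with
  | nil => simp
  | cons i l ih =>
    have h : Commute (x i ^ b i) (l.map fun j => x j ^ a j).prod := by
      refine Commute.list_prod_right _ _ fun y hy => ?_
      obtain ⟨j, -, rfl⟩ := List.mem_map.1 hy
      exact (hx i j).zpow_zpow _ _
    simp only [List.map_cons, List.prod_cons, ih]
    rw [zpow_add, mul_assoc, ← mul_assoc (x i ^ b i), h.eq]
    simp only [mul_assoc]

theorem groupMon_add_of_commute (x : Fin N → G) (hx : ∀ i j, Commute (x i) (x j))
    (a b : Fin N → ℤ) : groupMon x (a + b) = groupMon x a * groupMon x b :=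
  list_prod_zpow_add x hx a b _

variable {x : Fin N → G} {q : Fin N → Fin N → K}

theorem semiconjBy_groupMon (f : K →* G) (hf : ∀ k g, Commute (f k) g)
    (hx : ∀ i j, x i * x j = f (q i j) * (x j * x i))
    (i : Fin N) (a : Fin N → ℤ) :
    SemiconjBy (x i) (groupMon x a) (f (∏ j, q i j ^ a j) * groupMon x a) := by
  have key (l : List (Fin N)) : SemiconjBy (x i) (l.map fun j => x j ^ a j).prod
      (f (l.map fun j => q i j ^ a j).prod * (l.map fun j => x j ^ a j).prod) := by
    induction l with
    | nil => simp
    | cons j l ih =>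
      have h : SemiconjBy (x i) (x j ^ a j) (f (q i j ^ a j) * x j ^ a j) := by
        rw [map_zpow, ← (hf _ _).mul_zpow]
        exact SemiconjBy.zpow_right (by rw [SemiconjBy, hx, mul_assoc]) _
      have h' := h.mul_right ih
      rw [mul_assoc, ← mul_assoc (x j ^ a j), ← (hf _ (x j ^ a j)).eq, mul_assoc, ← mul_assoc] at h'
      simpa only [List.map_cons, List.prod_cons, map_mul] using h'
  rw [Fin.prod_univ_def]
  exact key _

theorem exists_groupMon_add (f : K →* G) (hf : ∀ k g, Commute (f k) g)
    (hx : ∀ i j, x i * x j = f (q i j) * (x j * x i))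
    (a b : Fin N → ℤ) :
    ∃ k, groupMon x a * groupMon x b = f k * groupMon x (a + b) := by
  have hN : f.range.Normal := by
    constructor
    rintro _ ⟨k, rfl⟩ g
    exact ⟨k, by rw [← (hf k g).eq, mul_inv_cancel_right]⟩
  have hcomm (i j : Fin N) : Commute (QuotientGroup.mk' f.range (x i))
      (QuotientGroup.mk' f.range (x j)) := by
    have hone : QuotientGroup.mk' f.range (f (q i j)) = 1 :=
      (QuotientGroup.eq_one_iff _).2 ⟨_, rfl⟩
    rw [Commute, SemiconjBy, ← map_mul, hx, map_mul, hone, one_mul, map_mul]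
  have h := groupMon_add_of_commute _ hcomm a b
  rw [← map_groupMon, ← map_groupMon, ← map_groupMon, ← map_mul] at h
  obtain ⟨k, hk⟩ := QuotientGroup.eq.1 h
  exact ⟨k, by rw [(hf _ _).eq, hk, mul_inv_cancel_left]⟩

theorem exists_groupMon_comm (f : K →* G) (hf : ∀ k g, Commute (f k) g)
    (hx : ∀ i j, x i * x j = f (q i j) * (x j * x i))
    (a b : Fin N → ℤ) :
    ∃ k, groupMon x a * groupMon x b = f k * (groupMon x b * groupMon x a) := by
  obtain ⟨k, hk⟩ := exists_groupMon_add f hf hx a b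
  obtain ⟨k', hk'⟩ := exists_groupMon_add f hf hx b a
  refine ⟨k * k'⁻¹, ?_⟩
  rw [hk, hk', add_comm b a, map_mul, map_inv, mul_assoc, inv_mul_cancel_left]

theorem exists_groupMon_neg (f : K →* G) (hf : ∀ k g, Commute (f k) g)
    (hx : ∀ i j, x i * x j = f (q i j) * (x j * x i))
    (a : Fin N → ℤ) :
    ∃ k, groupMon x (-a) = f k * (groupMon x a)⁻¹ := by
  obtain ⟨k, hk⟩ := exists_groupMon_add f hf hx (-a) a
  rw [neg_add_cancel, groupMon_zero, mul_one] at hk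
  exact ⟨k, eq_mul_inv_of_mul_eq hk⟩

end Monomials

/-- A saturated submodule of a finite free `ℤ`-module of rank `n` is spanned by the last members of
some spanning family of `n` vectors. -/
theorem exists_spanning_family_of_saturated {n : ℕ} (W : Submodule ℤ (Fin n → ℤ))
    (hW : ∀ (k : ℤ) (a : Fin n → ℤ), k ≠ 0 → k • a ∈ W → a ∈ W) :
    ∃ (m : ℕ) (v : Fin n → Fin n → ℤ), m ≤ n ∧ Submodule.span ℤ (Set.range v) = ⊤ ∧
      Submodule.span ℤ (v '' {i | m ≤ (i : ℕ)}) = W := by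
  have : Module.IsTorsionFree ℤ ((Fin n → ℤ) ⧸ W) := by
    refine Module.IsTorsionFree.of_smul_eq_zero fun k a h => ?_
    obtain ⟨a, rfl⟩ := W.mkQ_surjective a
    rw [← map_smul, Submodule.mkQ_apply, Submodule.Quotient.mk_eq_zero] at h
    rw [Submodule.mkQ_apply, Submodule.Quotient.mk_eq_zero]
    exact or_iff_not_imp_left.2 fun hk => hW k a hk h
  obtain ⟨k, bQ⟩ := Module.basisOfFiniteTypeTorsionFree' (R := ℤ) (M := (Fin n → ℤ) ⧸ W)
  obtain ⟨r, bW⟩ := Module.basisOfFiniteTypeTorsionFree' (R := ℤ) (M := W)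
  let b := ((bW.sumQuot bQ).reindex (Equiv.sumComm _ _)).reindex finSumFinEquiv
  obtain rfl : k + r = n := by
    simpa using (Module.finrank_eq_card_basis b).symm
  refine ⟨k, b, Nat.le_add_right _ _, b.span_eq, ?_⟩
  have himage : b '' {i | k ≤ (i : ℕ)} = Set.range (W.subtype ∘ bW) := by
    ext y
    constructor
    · rintro ⟨i, hi, rfl⟩
      induction i using Fin.addCases with
      | left i => exact absurd i.isLt (not_lt.2 (by simpa using hi))
      | right i => exact ⟨i, by simp [b]⟩
    · rintro ⟨i, rfl⟩
      exact ⟨Fin.natAdd k i, by simp, by simp [b]⟩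
  rw [himage, Set.range_comp, ← Submodule.map_span, bW.span_eq, Submodule.map_top,
    Submodule.range_subtype]

namespace IsTwistedLaurent

variable {C B : Type*} [CommRing C] [Ring B] [Algebra C B] {n : ℕ}
  {q : Fin n → Fin n → Cˣ} {x : Fin n → Bˣ}

/-- The exponent vectors of the central monomials. -/
def centralExponents (q : Fin n → Fin n → Cˣ) : Submodule ℤ (Fin n → ℤ) :=
  AddSubgroup.toIntSubmodule
    { carrier := {a | ∀ i, ∏ j, q i j ^ a j = 1}
      zero_mem' := by simp
      add_mem' := fun {a b} ha hb i => by
        simp [zpow_add, Finset.prod_mul_distrib, ha i, hb i]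
      neg_mem' := fun {a} ha i => by simp [ha i] }

theorem mem_centralExponents {a : Fin n → ℤ} :
    a ∈ centralExponents q ↔ ∀ i, ∏ j, q i j ^ a j = 1 :=
  Iff.rfl

theorem mem_centralExponents_of_zsmul_mem
    (hΓ : TorsionFreeSubgroup (Subgroup.closure
      (Set.range fun p : Fin n × Fin n => q p.1 p.2)))
    (k : ℤ) (a : Fin n → ℤ) (hk : k ≠ 0) (ha : k • a ∈ centralExponents q) :
    a ∈ centralExponents q := by
  intro i
  by_contra h
  have hmem : ∏ j, q i j ^ a j ∈ Subgroup.closure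
      (Set.range fun p : Fin n × Fin n => q p.1 p.2) :=
    Subgroup.prod_mem _ fun j _ => Subgroup.zpow_mem _ (Subgroup.subset_closure (Set.mem_range_self (i, j))) _
  refine hΓ _ hmem h (isOfFinOrder_iff_zpow_eq_one.2 ⟨k, hk, ?_⟩)
  rw [← Finset.prod_zpow, ← ha i]
  refine Finset.prod_congr rfl fun j _ => ?_
  rw [← zpow_mul, mul_comm, Pi.smul_apply, smul_eq_mul]

/-- Scalar units act through central units of the algebra. -/
theorem commute_map_algebraMap (k : Cˣ) (g : Bˣ) :
    Commute (Units.map (algebraMap C B).toMonoidHom k) g :=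
  Units.ext (Algebra.commutes (k : C) (g : B))

theorem coe_map_algebraMap_mul (k : Cˣ) (g : Bˣ) :
    ((Units.map (algebraMap C B).toMonoidHom k * g : Bˣ) : B) = (k : C) • (g : B) := by
  rw [Algebra.smul_def]
  rfl

theorem mul_eq (h : IsTwistedLaurent C B q x) (i j : Fin n) :
    x i * x j = Units.map (algebraMap C B).toMonoidHom (q i j) * (x j * x i) := by
  ext
  rw [coe_map_algebraMap_mul]
  exact h.rel i j

theorem mul_lmon (h : IsTwistedLaurent C B q x) (i : Fin n) (a : Fin n → ℤ) :
    (x i : B) * lmon x a = ((∏ j, q i j ^ a j : Cˣ) : C) • (lmon x a * x i) := by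
  have := congrArg Units.val
    (semiconjBy_groupMon _ commute_map_algebraMap h.mul_eq i a).eq
  rwa [mul_assoc, coe_map_algebraMap_mul, Units.val_mul, Units.val_mul, coe_groupMon] at this

theorem lmon_mem_center (h : IsTwistedLaurent C B q x) {a : Fin n → ℤ} (ha : a ∈ centralExponents q) :
    lmon x a ∈ Subalgebra.center C B := by
  have hc (i : Fin n) : Commute (lmon x a) (x i : B) := by
    have := h.mul_lmon i a
    rw [ha i, Units.val_one, one_smul] at this
    exact this.symm
  rw [Subalgebra.mem_center_iff]
  intro b
  induction h.spans b using Submodule.span_induction with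
  | mem y hy =>
    obtain ⟨s, rfl⟩ := hy
    refine (Commute.list_prod_right _ _ fun y hy => ?_ : Commute (lmon x a) (lmon x s)).eq.symm
    obtain ⟨i, -, rfl⟩ := List.mem_map.1 hy
    exact SemiconjBy.units_zpow_right (hc i) _
  | zero => simp
  | add y z _ _ hy hz => rw [add_mul, mul_add, hy, hz]
  | smul c y _ hy => rw [smul_mul_assoc, mul_smul_comm, hy]

theorem center_eq_span [IsDomain C] (h : IsTwistedLaurent C B q x) :
    Subalgebra.toSubmodule (Subalgebra.center C B) =
      Submodule.span C {b : B | ∃ a : Fin n → ℤ,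
        (∀ i : Fin n, (∏ j : Fin n, q i j ^ a j) = 1) ∧ b = lmon x a} := by
  apply le_antisymm
  · intro b hb
    obtain ⟨c, rfl⟩ := Finsupp.mem_span_range_iff_exists_finsupp.1 (h.spans b)
    refine Submodule.sum_mem _ fun a ha => Submodule.smul_mem _ _
      (Submodule.subset_span ⟨a, fun i => ?_, rfl⟩)
    have hcomm := (Subalgebra.mem_center_iff (R := C)).1 hb (x i)
    simp only [Finsupp.sum, Finset.mul_sum, Finset.sum_mul, mul_smul_comm, smul_mul_assoc,
      h.mul_lmon, smul_smul] at hcomm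
    simp only [← smul_mul_assoc, ← Finset.sum_mul] at hcomm
    have hsum := (x i).isUnit.mul_right_cancel hcomm
    rw [← sub_eq_zero, ← Finset.sum_sub_distrib] at hsum
    simp only [← sub_smul] at hsum
    have hzero := linearIndependent_iff'.1 h.free _ _ hsum a ha
    have hca : c a ≠ 0 := Finsupp.mem_support_iff.1 ha
    refine Units.ext (mul_left_cancel₀ hca ?_)
    rw [Units.val_one, mul_one]
    exact sub_eq_zero.1 hzero
  · rw [Submodule.span_le]
    rintro _ ⟨a, ha, rfl⟩
    exact h.lmon_mem_center ha

theorem lmon_mem_adjoin (h : IsTwistedLaurent C B q x) {ι : Type*} (v : ι → Fin n → ℤ)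
    (S : Set ι) {a : Fin n → ℤ}
    (ha : a ∈ Submodule.span ℤ (v '' S)) :
    lmon x a ∈ Algebra.adjoin C (((fun i => ((groupMon x (v i) : Bˣ) : B)) '' S) ∪
      ((fun i => (((groupMon x (v i))⁻¹ : Bˣ) : B)) '' S)) := by
  set A := Algebra.adjoin C (((fun i => ((groupMon x (v i) : Bˣ) : B)) '' S) ∪
      ((fun i => (((groupMon x (v i))⁻¹ : Bˣ) : B)) '' S))
  have hadd {s t : Fin n → ℤ} (hs : lmon x s ∈ A) (ht : lmon x t ∈ A) : lmon x (s + t) ∈ A := by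
    obtain ⟨k, hk⟩ := exists_groupMon_add _ commute_map_algebraMap h.mul_eq s t
    have hst : groupMon x (s + t) = Units.map (algebraMap C B).toMonoidHom k⁻¹ *
        (groupMon x s * groupMon x t) := by
      rw [hk, map_inv, inv_mul_cancel_left]
    rw [← coe_groupMon, hst, coe_map_algebraMap_mul, Units.val_mul, coe_groupMon, coe_groupMon]
    exact A.smul_mem (A.mul_mem hs ht) _
  suffices lmon x a ∈ A ∧ lmon x (-a) ∈ A from this.1
  rw [← Submodule.mem_toAddSubgroup, Submodule.span_int_eq_addSubgroupClosure] at ha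
  induction ha using AddSubgroup.closure_induction with
  | mem s hs =>
    obtain ⟨i, hi, rfl⟩ := hs
    obtain ⟨k, hk⟩ := exists_groupMon_neg _ commute_map_algebraMap h.mul_eq (v i)
    rw [← coe_groupMon, ← coe_groupMon, hk, coe_map_algebraMap_mul]
    exact ⟨Algebra.subset_adjoin (Or.inl ⟨i, hi, rfl⟩),
      A.smul_mem (Algebra.subset_adjoin (Or.inr ⟨i, hi, rfl⟩)) _⟩
  | zero => simp [← coe_groupMon]
  | add s t _ _ hs ht => exact ⟨hadd hs.1 ht.1, by rw [neg_add]; exact hadd hs.2 ht.2⟩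
  | neg s _ hs => exact ⟨hs.2, by rw [neg_neg]; exact hs.1⟩

end IsTwistedLaurent

/-- **Corollary 3.8 (key step).** Let `B = C_Q[x₁^{±1}, …, x_n^{±1}]` be an algebra of
twisted Laurent polynomials over a commutative Noetherian domain `C` whose commutation
parameters generate a torsionfree subgroup `Γ ⊆ C^*`.  Then the center of `B` is the
`C`-span of the monomials whose exponent vector `m` satisfies `∏_j q_{ij}^{m_j} = 1` for all
`i`; the set `G` of such exponent vectors is a subgroup of `ℤⁿ`; and there is a new set of
pairwise `q`-commuting Laurent generators `Y₁^{±1}, …, Y_n^{±1}` of `B` such that the center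
of `B` is generated by `Y_{m+1}^{±1}, …, Y_n^{±1}` for some `m`. -/
theorem twisted_laurent_center
    {C : Type*} [CommRing C] [IsDomain C] [IsNoetherianRing C] [CharZero C]
    {B : Type*} [Ring B] [Algebra C B]
    {n : ℕ} (q : Fin n → Fin n → Cˣ) (x : Fin n → Bˣ)
    (hTL : IsTwistedLaurent C B q x)
    (hΓ : TorsionFreeSubgroup (Subgroup.closure
      (Set.range fun p : Fin n × Fin n => q p.1 p.2))) :
    -- (a) the center is spanned by the monomials with exponents in `G`
    (Subalgebra.toSubmodule (Subalgebra.center C B) =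
      Submodule.span C {b : B | ∃ mv : Fin n → ℤ,
        (∀ i : Fin n, (∏ j : Fin n, q i j ^ mv j) = 1) ∧ b = lmon x mv}) ∧
    -- (b) the set `G` of such exponent vectors is a subgroup of `ℤⁿ`
    (∃ G : AddSubgroup (Fin n → ℤ),
      (G : Set (Fin n → ℤ)) =
        {mv : Fin n → ℤ | ∀ i : Fin n, (∏ j : Fin n, q i j ^ mv j) = 1}) ∧
    -- (c) new `q`-commuting generators, the last of which generate the center
    (∃ (mcut : ℕ) (Y : Fin n → Bˣ), mcut ≤ n ∧
      (∀ i j : Fin n, ∃ c : Cˣ,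
        (Y i : B) * (Y j : B) = ((c : Cˣ) : C) • ((Y j : B) * (Y i : B))) ∧
      Algebra.adjoin C ((Set.range fun i => ((Y i : B))) ∪
        (Set.range fun i => (((Y i)⁻¹ : Bˣ) : B))) = ⊤ ∧
      Subalgebra.center C B = Algebra.adjoin C
        (((fun i => ((Y i : B))) '' {i : Fin n | mcut ≤ (i : ℕ)}) ∪
          ((fun i => (((Y i)⁻¹ : Bˣ) : B)) '' {i : Fin n | mcut ≤ (i : ℕ)}))) := by
  refine ⟨hTL.center_eq_span, ⟨(IsTwistedLaurent.centralExponents q).toAddSubgroup, rfl⟩, ?_⟩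
  obtain ⟨m, v, hm, htop, hspan⟩ := exists_spanning_family_of_saturated
    (IsTwistedLaurent.centralExponents q) (IsTwistedLaurent.mem_centralExponents_of_zsmul_mem hΓ)
  refine ⟨m, fun i => groupMon x (v i), hm, fun i j => ?_, ?_, le_antisymm ?_ ?_⟩
  · obtain ⟨k, hk⟩ := exists_groupMon_comm _ IsTwistedLaurent.commute_map_algebraMap hTL.mul_eq
      (v i) (v j)
    refine ⟨k, ?_⟩
    rw [← Units.val_mul, hk, IsTwistedLaurent.coe_map_algebraMap_mul, Units.val_mul]
  · rw [← top_le_iff, ← Subalgebra.toSubmodule.le_iff_le]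
    intro b _
    refine Submodule.span_le.2 ?_ (hTL.spans b)
    rintro _ ⟨a, rfl⟩
    rw [← Set.image_univ, ← Set.image_univ]
    refine hTL.lmon_mem_adjoin v Set.univ ?_
    rw [Set.image_univ, htop]
    trivial
  · rw [← Subalgebra.toSubmodule.le_iff_le, hTL.center_eq_span, Submodule.span_le]
    rintro _ ⟨a, ha, rfl⟩
    exact hTL.lmon_mem_adjoin v _ (hspan.ge ha)
  · have hv (i : Fin n) (hi : m ≤ (i : ℕ)) :
        ((groupMon x (v i) : Bˣ) : B) ∈ Subalgebra.center C B := by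
      rw [coe_groupMon]
      exact hTL.lmon_mem_center (hspan.le (Submodule.subset_span ⟨i, hi, rfl⟩))
    refine Algebra.adjoin_le ?_
    rintro _ (⟨i, hi, rfl⟩ | ⟨i, hi, rfl⟩)
    · exact hv i hi
    · exact Set.units_inv_mem_center (hv i hi)

end Panov
end
end
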